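/- There exist a number of arms k ≥ 1, and for every sufficiently large horizon n a prior probability distribution Q over k-armed bandit environments, such that the Thompson Sampling policy under prior Q has Bayesian regret BR*_n(Q) ≥ (1/20)·√(k·n). -/

import Mathlib

open MeasureTheory ProbabilityTheory

namespace Bandit

/-- History of `t` rounds of interaction: the arm played and the reward observed
in each of the `t` rounds. -/
abbrev Hist (k t : ℕ) := Fin t → Fin k × ℝ

/-- A (possibly randomized, measurable) policy for a `k`-armed bandit:
at each round `t`, given the history of previously selected arms and observed rewards,
it selects the next arm according to a probability distribution, measurably in the history. -/
structure Policy (k : ℕ) where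
  act : ∀ t : ℕ, Hist k t → Measure (Fin k)
  measurable_act : ∀ t, Measurable (act t)
  prob_act : ∀ t h, IsProbabilityMeasure (act t h)

/-- The distribution of the history after `t` rounds of interaction between the
action rule `act` and the bandit environment with mean-reward vector `θ`, where the
reward observed upon playing arm `a` is `θ a` plus independent standard Gaussian noise. -/
noncomputable def traj {k : ℕ} (θ : Fin k → ℝ) (act : ∀ t : ℕ, Hist k t → Measure (Fin k)) :
    ∀ t : ℕ, Measure (Hist k t)
  | 0 => Measure.dirac Fin.elim0
  | t + 1 =>
      (traj θ act t).bind fun h =>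
        (act t h).bind fun a =>
          (gaussianReal (θ a) 1).map fun r => Fin.snoc h (a, r)

/-- The Bayesian `n`-round regret of the action rule `act` under the prior `Q` on
environments: the expectation, over `θ ∼ Q` and over the interaction (the Gaussian
noise and the policy's internal randomization), of the sum over the `n` rounds of the
gap between the best mean reward and the mean reward of the selected arm. -/
noncomputable def bayesRegret (k n : ℕ) (Q : Measure (Fin k → ℝ))
    (act : ∀ t : ℕ, Hist k t → Measure (Fin k)) : ℝ :=
  ∫ θ, (∫ h, (∑ t : Fin n, ((⨆ a, θ a) - θ (h t).1)) ∂(traj θ act n)) ∂Q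

end Bandit

namespace Bandit

/-- The posterior distribution over environments, given the prior `Q` and a history `h`
of selected arms and observed rewards, where the reward observed upon playing arm `a` in
environment `θ` is `θ a` plus independent standard Gaussian noise: the prior reweighted by
the Gaussian likelihood of the observed rewards, renormalized. -/
noncomputable def posterior {k : ℕ} (Q : Measure (Fin k → ℝ)) {t : ℕ} (h : Hist k t) :
    Measure (Fin k → ℝ) :=
  let ν := Q.withDensity fun θ =>
    ∏ s : Fin t, ENNReal.ofReal (gaussianPDFReal (θ (h s).1) 1 (h s).2)
  (ν Set.univ)⁻¹ • ν

open Classical in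
/-- The arm with the largest mean reward in environment `θ` (ties broken towards the
smallest index). -/
noncomputable def bestArm {k : ℕ} [NeZero k] (θ : Fin k → ℝ) : Fin k :=
  if hmax : (Finset.univ.filter fun a => ∀ b, θ b ≤ θ a).Nonempty then
    (Finset.univ.filter fun a => ∀ b, θ b ≤ θ a).min' hmax
  else ⟨0, Nat.pos_of_ne_zero (NeZero.ne k)⟩

/-- The action distribution of the Thompson Sampling policy under the prior `Q`: given the
history `h`, each arm `a` is selected with probability equal to the posterior probability
that `a` has the largest mean reward. -/
noncomputable def tsAct {k : ℕ} [NeZero k] (Q : Measure (Fin k → ℝ)) {t : ℕ}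
    (h : Hist k t) : Measure (Fin k) :=
  (posterior Q h).map bestArm

end Bandit
namespace Bandit

theorem measurable_snoc {k t : ℕ} (a : Fin k) :
    Measurable fun p : Hist k t × ℝ => (Fin.snoc p.1 (a, p.2) : Hist k (t + 1)) := by
  refine measurable_pi_iff.2 fun i => ?_
  refine Fin.lastCases ?_ (fun j => ?_) i
  · simp only [Fin.snoc_last]
    fun_prop
  · simp only [Fin.snoc_castSucc]
    fun_prop

/-- The law of the history after one more round, given the history `h` and the distribution
`μ` of the next arm. -/
noncomputable def stepLaw {k t : ℕ} (θ : Fin k → ℝ) (μ : Measure (Fin k)) (h : Hist k t) :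
    Measure (Hist k (t + 1)) :=
  μ.bind fun a => (gaussianReal (θ a) 1).map fun r => Fin.snoc h (a, r)

theorem lintegral_stepLaw {k t : ℕ} (θ : Fin k → ℝ) (μ : Measure (Fin k)) (h : Hist k t)
    {g : Hist k (t + 1) → ENNReal} (hg : Measurable g) :
    ∫⁻ x, g x ∂(stepLaw θ μ h) =
      ∫⁻ a, ∫⁻ r, g (Fin.snoc h (a, r)) ∂(gaussianReal (θ a) 1) ∂μ := by
  rw [stepLaw, Measure.lintegral_bind (measurable_of_countable _).aemeasurable hg.aemeasurable]
  congr with a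
  exact lintegral_map hg ((measurable_snoc a).comp measurable_prodMk_left)

theorem measurable_stepLaw {k t : ℕ} (θ : Fin k → ℝ) {act : Hist k t → Measure (Fin k)}
    (hact : Measurable act) : Measurable fun h => stepLaw θ (act h) h := by
  refine Measure.measurable_of_measurable_coe _ fun s hs => ?_
  have hg : Measurable (s.indicator (1 : Hist k (t + 1) → ENNReal)) := measurable_one.indicator hs
  simp only [← lintegral_indicator_one hs, lintegral_stepLaw θ _ _ hg, lintegral_fintype]
  refine Finset.measurable_sum _ fun a _ => ?_
  refine Measurable.mul ?_ ((Measure.measurable_coe (measurableSet_singleton a)).comp hact)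
  exact (hg.comp (measurable_snoc a)).lintegral_prod_right'

theorem traj_succ {k : ℕ} (θ : Fin k → ℝ) (act : ∀ t : ℕ, Hist k t → Measure (Fin k)) (t : ℕ) :
    traj θ act (t + 1) = (traj θ act t).bind fun h => stepLaw θ (act t h) h := rfl

theorem lintegral_traj_succ {k : ℕ} (θ : Fin k → ℝ) (π : Policy k) (t : ℕ)
    {g : Hist k (t + 1) → ENNReal} (hg : Measurable g) :
    ∫⁻ x, g x ∂(traj θ π.act (t + 1)) =
      ∫⁻ h, ∫⁻ a, ∫⁻ r, g (Fin.snoc h (a, r)) ∂(gaussianReal (θ a) 1) ∂(π.act t h)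
        ∂(traj θ π.act t) := by
  rw [traj_succ, Measure.lintegral_bind
    (measurable_stepLaw θ (π.measurable_act t)).aemeasurable hg.aemeasurable]
  simp only [lintegral_stepLaw θ _ _ hg]

theorem isProbabilityMeasure_traj {k : ℕ} (θ : Fin k → ℝ) (π : Policy k) (t : ℕ) :
    IsProbabilityMeasure (traj θ π.act t) := by
  induction t with
  | zero => exact Measure.dirac.isProbabilityMeasure
  | succ t ih =>
    have := π.prob_act t
    constructor
    rw [← lintegral_one, lintegral_traj_succ θ π t measurable_const]
    simp

theorem lintegral_mul_sq_le {α : Type*} [MeasurableSpace α] (μ : Measure α)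
    {f g : α → ENNReal} (hf : AEMeasurable f μ) (hg : AEMeasurable g μ) :
    (∫⁻ x, f x * g x ∂μ) ^ 2 ≤ (∫⁻ x, f x ^ 2 ∂μ) * ∫⁻ x, g x ^ 2 ∂μ := by
  have h := ENNReal.lintegral_mul_le_Lp_mul_Lq μ Real.HolderConjugate.two_two hf hg
  calc (∫⁻ x, f x * g x ∂μ) ^ 2 ≤ _ := pow_le_pow_left' h 2
    _ = _ := by
      rw [mul_pow, ← ENNReal.rpow_natCast, ← ENNReal.rpow_natCast, ← ENNReal.rpow_mul,
        ← ENNReal.rpow_mul]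
      norm_num

theorem sq_lintegral_le {α : Type*} [MeasurableSpace α] (μ : Measure α) [IsProbabilityMeasure μ]
    {f : α → ENNReal} (hf : AEMeasurable f μ) :
    (∫⁻ x, f x ∂μ) ^ 2 ≤ ∫⁻ x, f x ^ 2 ∂μ := by
  simpa using lintegral_mul_sq_le μ hf (aemeasurable_const (b := 1))

theorem gaussianPDFReal_sq (m₁ m₂ x : ℝ) :
    gaussianPDFReal m₂ 1 x ^ 2 =
      gaussianPDFReal m₁ 1 x *
        (Real.exp ((m₁ - m₂) ^ 2) * gaussianPDFReal (2 * m₂ - m₁) 1 x) := by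
  simp only [gaussianPDFReal, NNReal.coe_one, mul_one]
  rw [mul_pow, ← Real.exp_nat_mul]
  have : Real.exp (((2 : ℕ) : ℝ) * (-(x - m₂) ^ 2 / 2)) =
      Real.exp (-(x - m₁) ^ 2 / 2) *
        (Real.exp ((m₁ - m₂) ^ 2) * Real.exp (-(x - (2 * m₂ - m₁)) ^ 2 / 2)) := by
    rw [← Real.exp_add, ← Real.exp_add]
    congr 1
    push_cast
    ring
  rw [this]
  ring

theorem sq_lintegral_gaussianReal_le (m₁ m₂ : ℝ) {g : ℝ → ENNReal} (hg : Measurable g) :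
    (∫⁻ x, g x ∂(gaussianReal m₂ 1)) ^ 2 ≤
      ENNReal.ofReal (Real.exp ((m₁ - m₂) ^ 2)) * ∫⁻ x, g x ^ 2 ∂(gaussianReal m₁ 1) := by
  set ρ : ℝ → ENNReal := fun x =>
    ENNReal.ofReal (gaussianPDFReal m₂ 1 x / gaussianPDFReal m₁ 1 x)
  have hρ : Measurable ρ := by fun_prop
  have hpos : ∀ m x, 0 < gaussianPDFReal m 1 x := fun m x => gaussianPDFReal_pos m 1 x one_ne_zero
  have h₂ : ∫⁻ x, g x ∂(gaussianReal m₂ 1) = ∫⁻ x, g x * ρ x ∂(gaussianReal m₁ 1) := by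
    rw [gaussianReal_of_var_ne_zero _ one_ne_zero, gaussianReal_of_var_ne_zero _ one_ne_zero,
      lintegral_withDensity_eq_lintegral_mul _ (measurable_gaussianPDF _ _) hg,
      lintegral_withDensity_eq_lintegral_mul _ (measurable_gaussianPDF _ _)
        (show Measurable fun x => g x * ρ x from hg.mul hρ)]
    congr with x
    have : gaussianPDF m₂ 1 x = gaussianPDF m₁ 1 x * ρ x := by
      rw [gaussianPDF, gaussianPDF, ← ENNReal.ofReal_mul (hpos _ _).le,
        mul_div_cancel₀ _ (hpos _ _).ne']
    simp only [Pi.mul_apply, this]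
    ring
  have hρ₂ : ∫⁻ x, ρ x ^ 2 ∂(gaussianReal m₁ 1) = ENNReal.ofReal (Real.exp ((m₁ - m₂) ^ 2)) := by
    rw [gaussianReal_of_var_ne_zero _ one_ne_zero,
      lintegral_withDensity_eq_lintegral_mul _ (measurable_gaussianPDF _ _) (hρ.pow_const 2)]
    have : ∀ x, (gaussianPDF m₁ 1 * fun x => ρ x ^ 2) x =
        ENNReal.ofReal (Real.exp ((m₁ - m₂) ^ 2)) * gaussianPDF (2 * m₂ - m₁) 1 x := by
      intro x
      have h₁ := hpos m₁ x
      simp only [Pi.mul_apply, gaussianPDF, ρ]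
      rw [← ENNReal.ofReal_pow (div_nonneg (hpos _ _).le h₁.le), ← ENNReal.ofReal_mul h₁.le,
        ← ENNReal.ofReal_mul (Real.exp_pos _).le, div_pow, gaussianPDFReal_sq m₁ m₂ x]
      congr 1
      field_simp
    simp only [this]
    rw [lintegral_const_mul _ (measurable_gaussianPDF _ _),
      lintegral_gaussianPDF_eq_one _ one_ne_zero, mul_one]
  rw [h₂, mul_comm, ← hρ₂]
  exact lintegral_mul_sq_le _ hg.aemeasurable hρ.aemeasurable

/-- Change of environment: if two environments differ by exactly `Δ` in every arm, second moments
under one of them control first moments under the other. -/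
theorem sq_lintegral_traj_le {k : ℕ} {θ₁ θ₂ : Fin k → ℝ} {Δ : ℝ}
    (hθ : ∀ a, (θ₁ a - θ₂ a) ^ 2 = Δ ^ 2) (π : Policy k) (t : ℕ)
    {g : Hist k t → ENNReal} (hg : Measurable g) :
    (∫⁻ h, g h ∂(traj θ₂ π.act t)) ^ 2 ≤
      ENNReal.ofReal (Real.exp (t * Δ ^ 2)) * ∫⁻ h, g h ^ 2 ∂(traj θ₁ π.act t) := by
  induction t with
  | zero =>
    simp only [traj, Nat.cast_zero, zero_mul, Real.exp_zero, ENNReal.ofReal_one, one_mul]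
    rw [lintegral_dirac' _ hg, lintegral_dirac' _ (hg.pow_const 2)]
  | succ t ih =>
    have := π.prob_act t
    have hsnoc : ∀ (h : Hist k t) (a : Fin k),
        Measurable fun r => g (Fin.snoc h (a, r)) := fun h a =>
      hg.comp ((measurable_snoc a).comp measurable_prodMk_left)
    rw [lintegral_traj_succ θ₂ π t hg, lintegral_traj_succ θ₁ π t (hg.pow_const 2)]
    have hG : Measurable fun h : Hist k t =>
        ∫⁻ a, ∫⁻ r, g (Fin.snoc h (a, r)) ∂(gaussianReal (θ₂ a) 1) ∂(π.act t h) := by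
      simpa only [Function.comp_def, lintegral_stepLaw θ₂ _ _ hg] using
        (Measure.measurable_lintegral hg).comp (measurable_stepLaw θ₂ (π.measurable_act t))
    calc _ ≤ _ := ih hG
      _ ≤ ENNReal.ofReal (Real.exp (t * Δ ^ 2)) * ∫⁻ h, ENNReal.ofReal (Real.exp (Δ ^ 2)) *
            ∫⁻ a, ∫⁻ r, g (Fin.snoc h (a, r)) ^ 2 ∂(gaussianReal (θ₁ a) 1) ∂(π.act t h)
            ∂(traj θ₁ π.act t) := by
        gcongr with h
        rw [← lintegral_const_mul _ (measurable_of_countable _)]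
        refine (sq_lintegral_le _ (measurable_of_countable _).aemeasurable).trans ?_
        refine lintegral_mono fun a => ?_
        rw [← hθ a]
        exact sq_lintegral_gaussianReal_le _ _ (hsnoc h a)
      _ = _ := by
        rw [lintegral_const_mul' _ _ ENNReal.ofReal_ne_top, ← mul_assoc,
          ← ENNReal.ofReal_mul (Real.exp_pos _).le, ← Real.exp_add]
        push_cast
        ring_nf

theorem sq_integral_traj_le {k : ℕ} {θ₁ θ₂ : Fin k → ℝ} {Δ : ℝ}
    (hθ : ∀ a, (θ₁ a - θ₂ a) ^ 2 = Δ ^ 2) (π : Policy k) (t : ℕ)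
    {f : Hist k t → ℝ} (hf : Measurable f) (hf₀ : ∀ h, 0 ≤ f h) (hf₁ : ∀ h, f h ≤ 1) :
    (∫ h, f h ∂(traj θ₂ π.act t)) ^ 2 ≤
      Real.exp (t * Δ ^ 2) * ∫ h, f h ∂(traj θ₁ π.act t) := by
  have hint : ∀ θ, Integrable f (traj θ π.act t) := fun θ =>
    have := isProbabilityMeasure_traj θ π t
    Integrable.of_bound hf.aestronglyMeasurable 1
      (ae_of_all _ fun h => by rw [Real.norm_of_nonneg (hf₀ h)]; exact hf₁ h)
  have h := sq_lintegral_traj_le hθ π t hf.ennreal_ofReal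
  have h' : ∫⁻ h, ENNReal.ofReal (f h) ^ 2 ∂(traj θ₁ π.act t) ≤
      ∫⁻ h, ENNReal.ofReal (f h) ∂(traj θ₁ π.act t) := by
    refine lintegral_mono fun x => ?_
    rw [← ENNReal.ofReal_pow (hf₀ x)]
    exact ENNReal.ofReal_le_ofReal (by nlinarith [hf₀ x, hf₁ x])
  have h := h.trans (mul_le_mul_right h' _)
  rw [← ofReal_integral_eq_lintegral_ofReal (hint _) (ae_of_all _ hf₀),
    ← ofReal_integral_eq_lintegral_ofReal (hint _) (ae_of_all _ hf₀),
    ← ENNReal.ofReal_pow (integral_nonneg hf₀), ← ENNReal.ofReal_mul (Real.exp_pos _).le] at h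
  exact (ENNReal.ofReal_le_ofReal_iff
    (mul_nonneg (Real.exp_pos _).le (integral_nonneg hf₀))).1 h

/-- The uniform distribution on two points. -/
noncomputable def twoPoint {α : Type*} [MeasurableSpace α] (x y : α) : Measure α :=
  (2⁻¹ : ENNReal) • Measure.dirac x + (2⁻¹ : ENNReal) • Measure.dirac y

instance {α : Type*} [MeasurableSpace α] (x y : α) : IsProbabilityMeasure (twoPoint x y) :=
  ⟨by simp [twoPoint, ENNReal.inv_two_add_inv_two]⟩

section TwoPoint

variable {k : ℕ} (θ₁ θ₂ : Fin k → ℝ)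

/-- The likelihood of the rewards recorded in the history `h` in the environment `θ`. -/
noncomputable def likelihood {k t : ℕ} (h : Hist k t) (θ : Fin k → ℝ) : ENNReal :=
  ∏ s : Fin t, ENNReal.ofReal (gaussianPDFReal (θ (h s).1) 1 (h s).2)

theorem measurable_likelihood {k t : ℕ} (θ : Fin k → ℝ) :
    Measurable fun h : Hist k t => likelihood h θ := by
  refine Finset.measurable_prod _ fun s _ => Measurable.ennreal_ofReal ?_
  have : Measurable fun p : Fin k × ℝ => gaussianPDFReal (θ p.1) 1 p.2 :=
    measurable_from_prod_countable_right fun a => measurable_gaussianPDFReal (θ a) 1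
  exact this.comp (measurable_pi_apply s)

theorem likelihood_ne_zero {k t : ℕ} (h : Hist k t) (θ : Fin k → ℝ) : likelihood h θ ≠ 0 :=
  Finset.prod_ne_zero_iff.2 fun s _ => by
    simpa using gaussianPDFReal_pos (θ (h s).1) 1 (h s).2 one_ne_zero

theorem likelihood_ne_top {k t : ℕ} (h : Hist k t) (θ : Fin k → ℝ) : likelihood h θ ≠ ⊤ :=
  ENNReal.prod_ne_top fun _ _ => ENNReal.ofReal_ne_top

theorem withDensity_twoPoint {α : Type*} [MeasurableSpace α] [MeasurableSingletonClass α]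
    (x y : α) (f : α → ENNReal) :
    (twoPoint x y).withDensity f =
      (2⁻¹ * f x) • Measure.dirac x + (2⁻¹ * f y) • Measure.dirac y := by
  ext s hs
  rw [withDensity_apply _ hs, twoPoint, Measure.restrict_add, lintegral_add_measure,
    Measure.restrict_smul, Measure.restrict_smul, lintegral_smul_measure, lintegral_smul_measure]
  classical
  rw [setLIntegral_dirac, setLIntegral_dirac]
  by_cases hx : x ∈ s <;> by_cases hy : y ∈ s <;> simp [hs, hx, hy]

theorem posterior_twoPoint {t : ℕ} (h : Hist k t) :
    posterior (twoPoint θ₁ θ₂) h =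
      (2⁻¹ * likelihood h θ₁ + 2⁻¹ * likelihood h θ₂)⁻¹ •
        ((2⁻¹ * likelihood h θ₁) • Measure.dirac θ₁ +
          (2⁻¹ * likelihood h θ₂) • Measure.dirac θ₂) := by
  have hd := withDensity_twoPoint θ₁ θ₂ (likelihood h)
  unfold likelihood at hd ⊢
  simp only [posterior, hd]
  simp

theorem aemeasurable_posterior_twoPoint {β : Type*} [MeasurableSpace β] {t : ℕ} (h : Hist k t)
    (f : (Fin k → ℝ) → β) : AEMeasurable f (posterior (twoPoint θ₁ θ₂) h) := by
  rw [posterior_twoPoint]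
  exact ((aemeasurable_dirac.smul_measure _).add_measure
    (aemeasurable_dirac.smul_measure _)).smul_measure _

theorem tsAct_twoPoint [NeZero k] {t : ℕ} (h : Hist k t) :
    tsAct (twoPoint θ₁ θ₂) h =
      (2⁻¹ * likelihood h θ₁ + 2⁻¹ * likelihood h θ₂)⁻¹ •
        ((2⁻¹ * likelihood h θ₁) • Measure.dirac (bestArm θ₁) +
          (2⁻¹ * likelihood h θ₂) • Measure.dirac (bestArm θ₂)) := by
  ext s hs
  rw [tsAct, Measure.map_apply_of_aemeasurable (aemeasurable_posterior_twoPoint _ _ _ _) hs,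
    posterior_twoPoint]
  simp only [Measure.smul_apply, Measure.add_apply, Measure.dirac_apply,
    Measure.dirac_apply' _ hs]
  rfl

/-- Thompson Sampling under the uniform prior on two environments. -/
noncomputable def tsPolicy [NeZero k] : Policy k where
  act _ h := tsAct (twoPoint θ₁ θ₂) h
  measurable_act t := by
    refine Measure.measurable_of_measurable_coe _ fun s _ => ?_
    have h₁ := measurable_likelihood (t := t) θ₁
    have h₂ := measurable_likelihood (t := t) θ₂
    simp only [tsAct_twoPoint, Measure.smul_apply, Measure.add_apply, smul_eq_mul]
    fun_prop
  prob_act t h := by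
    constructor
    rw [tsAct_twoPoint]
    simp only [Measure.smul_apply, Measure.add_apply, smul_eq_mul, measure_univ, mul_one]
    refine ENNReal.inv_mul_cancel ?_ ?_
    · simp [likelihood_ne_zero]
    · exact ENNReal.add_ne_top.2 ⟨ENNReal.mul_ne_top (by simp) (likelihood_ne_top _ _),
        ENNReal.mul_ne_top (by simp) (likelihood_ne_top _ _)⟩

end TwoPoint

/-- The fraction of rounds in which the arm `a` was played. -/
noncomputable def playFraction {k n : ℕ} (a : Fin k) (h : Hist k n) : ℝ :=
  (∑ t : Fin n, if (h t).1 = a then 1 else 0) / n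

theorem measurable_playFraction {k n : ℕ} (a : Fin k) :
    Measurable (playFraction (n := n) a) := by
  refine (Finset.measurable_sum _ fun t _ => ?_).div_const _
  exact (measurable_of_countable fun b : Fin k => if b = a then (1 : ℝ) else 0).comp
    (measurable_fst.comp (measurable_pi_apply t))

theorem playFraction_nonneg {k n : ℕ} (a : Fin k) (h : Hist k n) : 0 ≤ playFraction a h := by
  unfold playFraction
  positivity

theorem playFraction_le_one {k n : ℕ} (a : Fin k) (h : Hist k n) : playFraction a h ≤ 1 := by
  refine div_le_one_of_le₀ ?_ n.cast_nonneg
  calc _ ≤ ∑ _t : Fin n, (1 : ℝ) := Finset.sum_le_sum fun t _ => by split_ifs <;> norm_num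
    _ = n := by simp

theorem iSup_pair {α : Type*} [ConditionallyCompleteLattice α] (f : Fin 2 → α) :
    ⨆ a, f a = f 0 ⊔ f 1 := by
  apply le_antisymm
  · exact ciSup_le fun a => by fin_cases a <;> simp
  · exact sup_le (le_ciSup (Set.finite_range f).bddAbove 0)
      (le_ciSup (Set.finite_range f).bddAbove 1)

theorem bayesRegret_twoPoint {n : ℕ} (hn : 0 < n) {Δ : ℝ} (hΔ : 0 ≤ Δ) (π : Policy 2) :
    bayesRegret 2 n (twoPoint ![Δ, 0] ![0, Δ]) π.act =
      n * Δ / 2 * (1 + ∫ h, playFraction 1 h ∂(traj ![Δ, 0] π.act n)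
        - ∫ h, playFraction 1 h ∂(traj ![0, Δ] π.act n)) := by
  have hn' : (n : ℝ) ≠ 0 := by positivity
  have := isProbabilityMeasure_traj ![0, Δ] π n
  have hint : Integrable (playFraction 1) (traj ![0, Δ] π.act n) :=
    Integrable.of_bound (measurable_playFraction 1).aestronglyMeasurable 1
      (ae_of_all _ fun h => by
        rw [Real.norm_of_nonneg (playFraction_nonneg 1 h)]; exact playFraction_le_one 1 h)
  have hsum : ∀ h : Hist 2 n,
      (n : ℝ) * playFraction 1 h = ∑ t : Fin n, if (h t).1 = 1 then 1 else 0 := fun h =>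
    mul_div_cancel₀ _ hn'
  have gap₁ : ∀ h : Hist 2 n, ∑ t : Fin n, ((⨆ a, ![Δ, 0] a) - ![Δ, 0] (h t).1) =
      n * Δ * playFraction 1 h := by
    intro h
    rw [mul_right_comm, hsum, Finset.sum_mul]
    refine Finset.sum_congr rfl fun t _ => ?_
    generalize (h t).1 = a
    fin_cases a <;> simp [iSup_pair, hΔ]
  have gap₂ : ∀ h : Hist 2 n, ∑ t : Fin n, ((⨆ a, ![0, Δ] a) - ![0, Δ] (h t).1) =
      n * Δ * (1 - playFraction 1 h) := by
    intro h
    rw [mul_one_sub, mul_right_comm, hsum, Finset.sum_mul, eq_sub_iff_add_eq,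
      ← Finset.sum_add_distrib]
    calc _ = ∑ _t : Fin n, Δ := Finset.sum_congr rfl fun t _ => by
          generalize (h t).1 = a
          fin_cases a <;> simp [iSup_pair, hΔ]
      _ = n * Δ := by simp
  have hi : ∀ (F : (Fin 2 → ℝ) → ℝ) (x : Fin 2 → ℝ),
      Integrable F ((2⁻¹ : ENNReal) • Measure.dirac x) := fun F x =>
    (integrable_dirac (by simp)).smul_measure (by simp)
  rw [bayesRegret, twoPoint, integral_add_measure (hi _ _) (hi _ _), integral_smul_measure,
    integral_smul_measure, integral_dirac, integral_dirac]
  simp only [gap₁, gap₂, integral_const_mul]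
  rw [integral_sub (integrable_const _) hint]
  simp
  ring

end Bandit

open Bandit in
/-- There is a number of arms `k ≥ 1` such that, for every sufficiently large horizon `n`,
there is a prior probability distribution `Q` over `k`-armed bandit environments
`θ ∈ [0,1]^k` for which the Thompson Sampling policy under `Q` has Bayesian regret at
least `(1/20) * √(k * n)`. -/
theorem thompson_sampling_bayesian_regret_lower_bound :
    ∃ k : ℕ, ∃ hk : 1 ≤ k, ∃ N : ℕ, ∀ n : ℕ, N ≤ n →
      ∃ Q : Measure (Fin k → ℝ), IsProbabilityMeasure Q ∧
        (∀ᵐ θ ∂Q, ∀ a, θ a ∈ Set.Icc (0 : ℝ) 1) ∧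
        ((1 / 20 : ℝ) * Real.sqrt (k * n) ≤
          bayesRegret k n Q (fun _t h =>
            @tsAct k ⟨Nat.one_le_iff_ne_zero.mp hk⟩ Q _ h)) := by
  refine ⟨2, one_le_two, 1, fun n hn => ?_⟩
  have hn₀ : (0 : ℝ) < n := by exact_mod_cast hn
  have hs : 0 < √(n : ℝ) := Real.sqrt_pos.2 hn₀
  have hs₂ : √(n : ℝ) * √(n : ℝ) = n := Real.mul_self_sqrt hn₀.le
  set Δ : ℝ := 1 / (2 * √(n : ℝ)) with hΔ
  have hΔ₀ : 0 ≤ Δ := by positivity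
  have hΔ₁ : Δ ≤ 1 := by
    have : 1 ≤ √(n : ℝ) := Real.one_le_sqrt.2 (by exact_mod_cast hn)
    rw [hΔ, div_le_one (by positivity)]
    linarith
  have hnΔ : (n : ℝ) * Δ = √(n : ℝ) / 2 := by
    rw [hΔ]
    nth_rewrite 1 [← hs₂]
    field_simp
  have hnΔ₂ : (n : ℝ) * Δ ^ 2 = 1 / 4 := by
    rw [pow_two, ← mul_assoc, hnΔ, hΔ]
    field_simp
    norm_num
  refine ⟨twoPoint ![Δ, 0] ![0, Δ], inferInstance, ?_, ?_⟩
  · rw [twoPoint, ae_add_measure_iff]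
    constructor <;> refine Measure.ae_smul_measure ?_ _ <;> rw [ae_dirac_eq] <;>
      simp [Fin.forall_fin_two, hΔ₀, hΔ₁]
  · change _ ≤ bayesRegret 2 n _ (tsPolicy ![Δ, 0] ![0, Δ]).act
    rw [bayesRegret_twoPoint hn hΔ₀, hnΔ]
    have hsq := sq_integral_traj_le (θ₁ := ![Δ, 0]) (θ₂ := ![0, Δ]) (Δ := Δ)
      (fun a => by fin_cases a <;> simp) (tsPolicy ![Δ, 0] ![0, Δ]) n
      (measurable_playFraction 1) (playFraction_nonneg 1) (playFraction_le_one 1)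
    have hx : 0 ≤ ∫ h, playFraction 1 h ∂(traj ![Δ, 0] (tsPolicy ![Δ, 0] ![0, Δ]).act n) :=
      integral_nonneg (playFraction_nonneg 1)
    rw [hnΔ₂] at hsq
    have hexp : Real.exp (1 / 4) ≤ 2 :=
      (Real.le_log_iff_exp_le two_pos).1 (by linarith [Real.log_two_gt_d9])
    have h2 : √(2 : ℝ) ≤ 2 := Real.sqrt_le_iff.2 (by norm_num)
    rw [Nat.cast_ofNat, Real.sqrt_mul zero_le_two]
    generalize ∫ h, playFraction 1 h ∂(traj ![Δ, 0] _ n) = x at *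
    generalize ∫ h, playFraction 1 h ∂(traj ![0, Δ] _ n) = y at *
    have hxy : 1 / 2 ≤ 1 + x - y := by nlinarith [sq_nonneg (y - 1)]
    nlinarith
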